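/- arXiv:1804.09897 — 2 statements merged into one kernel-verified Lean document; each statement's English description precedes it below -/
import Mathlib

section
/- In any quasi completely regular semiring S, the relations J*⁺ and D*⁺ coincide. -/
/-- A "semiring" in the sense of the paper: both reducts are semigroups
(no commutativity, no identities) and multiplication distributes over
addition on both sides. -/
class PSemiring (S : Type*) extends AddSemigroup S, Semigroup S where
  left_distrib : ∀ a b c : S, a * (b + c) = a * b + a * c
  right_distrib : ∀ a b c : S, (a + b) * c = a * c + b * c

namespace PSemiring

variable {S : Type*} [PSemiring S]

/-- `nmul n a` is the `(n+1)`-fold sum `a + ⋯ + a`; thus the positive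
multiple `m·a` of the paper is `nmul (m-1) a`. -/
def nmul : ℕ → S → S
  | 0, a => a
  | n + 1, a => nmul n a + a

/-- `a` is additively regular. -/
def AddRegular (a : S) : Prop := ∃ x, a + x + a = a

/-- `a` is a completely regular element. -/
def CompletelyRegularElem (a : S) : Prop :=
  ∃ x, a = a + x + a ∧ a + x = x + a ∧ a * (a + x) = a + x

/-- `S` is a quasi completely regular semiring. -/
def QuasiCompletelyRegular (S : Type*) [PSemiring S] : Prop :=
  ∀ a : S, ∃ n : ℕ, CompletelyRegularElem (nmul n a)

/-- `S` is a completely regular semiring. -/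
def CompletelyRegularSemiring (S : Type*) [PSemiring S] : Prop :=
  ∀ a : S, CompletelyRegularElem a

/-- `e` is an additive idempotent (i.e. `e ∈ E⁺(S)`). -/
def AddIdem (e : S) : Prop := e + e = e

/-- `V⁺(a)`, the set of additive inverses of `a`. -/
def Vplus (a : S) : Set S := {x | a + x + a = a ∧ x + a + x = x}

/-- `{a} ∪ (S + a)`. -/
def lset (a : S) : Set S := insert a {x | ∃ s, x = s + a}

/-- `{a} ∪ (a + S)`. -/
def rset (a : S) : Set S := insert a {x | ∃ s, x = a + s}

/-- `{a} ∪ (S + a) ∪ (a + S) ∪ (S + a + S)`. -/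
def jset (a : S) : Set S :=
  insert a ({x | ∃ s, x = s + a} ∪ {x | ∃ s, x = a + s} ∪ {x | ∃ s t, x = s + a + t})

/-- Green's relation `L⁺` on the additive reduct. -/
def GreenL (a b : S) : Prop := lset a = lset b

/-- Green's relation `R⁺` on the additive reduct. -/
def GreenR (a b : S) : Prop := rset a = rset b

/-- Green's relation `J⁺` on the additive reduct. -/
def GreenJ (a b : S) : Prop := jset a = jset b

/-- `n` is the least index such that the `(n+1)`-fold sum of `a` is additively
regular, i.e. `(n+1)·a` is the least additively regular positive multiple. -/
def LeastReg (a : S) (n : ℕ) : Prop :=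
  AddRegular (nmul n a) ∧ ∀ m < n, ¬ AddRegular (nmul m a)

/-- The relation `L*⁺`. -/
def LStar (a b : S) : Prop :=
  ∃ p q, LeastReg a p ∧ LeastReg b q ∧ GreenL (nmul p a) (nmul q b)

/-- The relation `R*⁺`. -/
def RStar (a b : S) : Prop :=
  ∃ p q, LeastReg a p ∧ LeastReg b q ∧ GreenR (nmul p a) (nmul q b)

/-- The relation `J*⁺`. -/
def JStar (a b : S) : Prop :=
  ∃ p q, LeastReg a p ∧ LeastReg b q ∧ GreenJ (nmul p a) (nmul q b)

/-- `H*⁺ = L*⁺ ∩ R*⁺`. -/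
def HStar (a b : S) : Prop := LStar a b ∧ RStar a b

/-- `D*⁺ = L*⁺ ∘ R*⁺` (relational composition). -/
def DStar (a b : S) : Prop := ∃ c, LStar a c ∧ RStar c b

/-- `z = 0_a`: `z = na + x` where `n` is the least positive integer with `na`
completely regular and `x` is the (unique) element with `na = na+x+na`,
`x = x+na+x` and `na+x = x+na`. -/
def IsZeroOf (a z : S) : Prop :=
  ∃ n x, (CompletelyRegularElem (nmul n a) ∧
      ∀ m < n, ¬ CompletelyRegularElem (nmul m a)) ∧
    nmul n a = nmul n a + x + nmul n a ∧ x = x + nmul n a + x ∧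
    nmul n a + x = x + nmul n a ∧ z = nmul n a + x

/-- The relation `𝒴`, relative to a choice `z` of the map `a ↦ 0_a`. -/
def Yrel (z : S → S) (a b : S) : Prop := Vplus (a + z a) = Vplus (b + z b)

/-- A (semiring) congruence. -/
structure IsCong (r : S → S → Prop) : Prop where
  refl : ∀ a, r a a
  symm : ∀ {a b}, r a b → r b a
  trans : ∀ {a b c}, r a b → r b c → r a c
  addl : ∀ (c : S) {a b}, r a b → r (c + a) (c + b)
  addr : ∀ (c : S) {a b}, r a b → r (a + c) (b + c)
  mull : ∀ (c : S) {a b}, r a b → r (c * a) (c * b)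
  mulr : ∀ (c : S) {a b}, r a b → r (a * c) (b * c)

/-- `r` is a b-lattice congruence: `S/r` is a b-lattice. -/
def IsBLatticeCong (r : S → S → Prop) : Prop :=
  IsCong r ∧ (∀ a : S, r (a * a) a) ∧ (∀ a : S, r (a + a) a) ∧
    ∀ a b : S, r (a + b) (b + a)

/-- `r` is the least b-lattice congruence. -/
def IsLeastBLatticeCong (r : S → S → Prop) : Prop :=
  IsBLatticeCong r ∧ ∀ r', IsBLatticeCong r' → ∀ a b, r a b → r' a b

/-- `r` is a skew-ring congruence: `S/r` is a semiring whose additive reduct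
is a group (expressed by solvability of both translation equations). -/
def IsSkewRingCong (r : S → S → Prop) : Prop :=
  IsCong r ∧ ∀ a b : S, (∃ x, r (a + x) b) ∧ ∃ y, r (y + a) b

/-- `r` is the least skew-ring congruence. -/
def IsLeastSkewRingCong (r : S → S → Prop) : Prop :=
  IsSkewRingCong r ∧ ∀ r', IsSkewRingCong r' → ∀ a b, r a b → r' a b

/-- `η` is a b-lattice-of-skew-rings congruence: `S/η` admits a congruence `ξ`
(given here as a congruence on `S` containing `η`) such that `(S/η)/ξ` is a
b-lattice and every `ξ`-class of `S/η` is a subsemiring whose additive reduct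
is a group. -/
def IsBLSRCong (η : S → S → Prop) : Prop :=
  IsCong η ∧ ∃ ξ : S → S → Prop, IsCong ξ ∧ (∀ a b, η a b → ξ a b) ∧
    (∀ a : S, ξ (a * a) a) ∧ (∀ a : S, ξ (a + a) a) ∧
    (∀ a b : S, ξ (a + b) (b + a)) ∧
    (∀ a b, ξ a b → ξ (a + b) a ∧ ξ (a * b) a) ∧
    ∀ a b, ξ a b → (∃ x, ξ x a ∧ η (a + x) b) ∧ ∃ y, ξ y a ∧ η (y + a) b

/-- `ν` is the least b-lattice-of-skew-rings congruence. -/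
def IsLeastBLSRCong (ν : S → S → Prop) : Prop :=
  IsBLSRCong ν ∧ ∀ η, IsBLSRCong η → ∀ a b, ν a b → η a b

/-- `r` is a completely regular semiring congruence: `S/r` is completely
regular. -/
def IsCRCong (r : S → S → Prop) : Prop :=
  IsCong r ∧ ∀ a : S, ∃ x, r a (a + x + a) ∧ r (a + x) (x + a) ∧
    r (a * (a + x)) (a + x)

/-- `ρ` is the least completely regular semiring congruence. -/
def IsLeastCRCong (r : S → S → Prop) : Prop :=
  IsCRCong r ∧ ∀ r', IsCRCong r' → ∀ a b, r a b → r' a b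

/-- `S` is quasi-orthodox. -/
def QuasiOrthodox (S : Type*) [PSemiring S] : Prop :=
  ∀ e f : S, AddIdem e → AddIdem f →
    ∃ n : ℕ, nmul n (e + f) = nmul (n + 1) (e + f)

/-- `S` is a completely Archimedean semiring. -/
def CompletelyArchimedean (S : Type*) [PSemiring S] : Prop :=
  QuasiCompletelyRegular S ∧ ∀ a b : S, JStar a b

/-- `r` is the least congruence containing the relation `τ`. -/
def IsLeastCongContaining (τ r : S → S → Prop) : Prop :=
  IsCong r ∧ (∀ a b, τ a b → r a b) ∧
    ∀ r', IsCong r' → (∀ a b, τ a b → r' a b) → ∀ a b, r a b → r' a b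

/-- `r` is a generalized additive idempotent pure congruence (purity part). -/
def GenAddIdemPure (r : S → S → Prop) : Prop :=
  ∀ a e : S, AddIdem e → r a e → ∃ n : ℕ, nmul n a = nmul (n + 1) a

/-- `τ^e`: `a = x + c + y`, `b = x + d + y` for some `(c,d) ∈ τ`, where each of
`x`, `y` may also be absent (i.e. `x, y ∈ S⁰`). -/
def relE (τ : S → S → Prop) (a b : S) : Prop :=
  ∃ c d, τ c d ∧ ((a = c ∧ b = d) ∨ (∃ x, a = x + c ∧ b = x + d) ∨
    (∃ y, a = c + y ∧ b = d + y) ∨ ∃ x y, a = x + c + y ∧ b = x + d + y)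

/-- `τ^♮`: the transitive closure of `(τ ∪ τ⁻¹ ∪ ε)^e`. -/
def natClosure (τ : S → S → Prop) : S → S → Prop :=
  Relation.TransGen (relE (fun a b => τ a b ∨ τ b a ∨ a = b))

end PSemiring

open PSemiring

namespace PSemiring

variable {S : Type*} [PSemiring S]

lemma greenL_iff {a b : S} :
    GreenL a b ↔ (a = b ∨ ∃ s, a = s + b) ∧ (b = a ∨ ∃ s, b = s + a) := by
  constructor
  · intro h
    have ha : a ∈ lset b := h ▸ Set.mem_insert a _
    have hb : b ∈ lset a := h ▸ Set.mem_insert b _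
    exact ⟨ha, hb⟩
  · have key : ∀ {a b : S}, (a = b ∨ ∃ s, a = s + b) → lset a ⊆ lset b := by
      rintro a b h x (rfl | ⟨s, rfl⟩)
      · exact h
      · rcases h with rfl | ⟨t, rfl⟩
        · exact Or.inr ⟨s, rfl⟩
        · exact Or.inr ⟨s + t, by simp only [add_assoc]⟩
    exact fun h => (key h.1).antisymm (key h.2)

lemma greenR_iff {a b : S} :
    GreenR a b ↔ (a = b ∨ ∃ s, a = b + s) ∧ (b = a ∨ ∃ s, b = a + s) := by
  constructor
  · intro h
    have ha : a ∈ rset b := h ▸ Set.mem_insert a _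
    have hb : b ∈ rset a := h ▸ Set.mem_insert b _
    exact ⟨ha, hb⟩
  · have key : ∀ {a b : S}, (a = b ∨ ∃ s, a = b + s) → rset a ⊆ rset b := by
      rintro a b h x (rfl | ⟨s, rfl⟩)
      · exact h
      · rcases h with rfl | ⟨t, rfl⟩
        · exact Or.inr ⟨s, rfl⟩
        · exact Or.inr ⟨t + s, by simp only [add_assoc]⟩
    exact fun h => (key h.1).antisymm (key h.2)

lemma jset_subset {a b : S} (h : a ∈ jset b) : jset a ⊆ jset b := by
  have left : ∀ {x : S} (s : S), x ∈ jset b → s + x ∈ jset b := by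
    rintro x s (rfl | ((⟨t, rfl⟩ | ⟨t, rfl⟩) | ⟨t, r, rfl⟩))
    · exact Or.inr (Or.inl (Or.inl ⟨s, rfl⟩))
    · exact Or.inr (Or.inl (Or.inl ⟨s + t, by simp only [add_assoc]⟩))
    · exact Or.inr (Or.inr ⟨s, t, by simp only [add_assoc]⟩)
    · exact Or.inr (Or.inr ⟨s + t, r, by simp only [add_assoc]⟩)
  have right : ∀ {x : S} (s : S), x ∈ jset b → x + s ∈ jset b := by
    rintro x s (rfl | ((⟨t, rfl⟩ | ⟨t, rfl⟩) | ⟨t, r, rfl⟩))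
    · exact Or.inr (Or.inl (Or.inr ⟨s, rfl⟩))
    · exact Or.inr (Or.inr ⟨t, s, by simp only [add_assoc]⟩)
    · exact Or.inr (Or.inl (Or.inr ⟨t + s, by simp only [add_assoc]⟩))
    · exact Or.inr (Or.inr ⟨t, r + s, by simp only [add_assoc]⟩)
  rintro x (rfl | ((⟨s, rfl⟩ | ⟨s, rfl⟩) | ⟨s, t, rfl⟩))
  · exact h
  · exact left s h
  · exact right s h
  · exact right t (left s h)

lemma GreenL.greenJ {a b : S} (h : GreenL a b) : GreenJ a b := by
  have key : ∀ {a b : S}, (a = b ∨ ∃ s, a = s + b) → a ∈ jset b := by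
    rintro a b (h | h)
    · exact Or.inl h
    · exact Or.inr (Or.inl (Or.inl h))
  obtain ⟨h₁, h₂⟩ := greenL_iff.1 h
  exact (jset_subset (key h₁)).antisymm (jset_subset (key h₂))

lemma GreenR.greenJ {a b : S} (h : GreenR a b) : GreenJ a b := by
  have key : ∀ {a b : S}, (a = b ∨ ∃ s, a = b + s) → a ∈ jset b := by
    rintro a b (h | h)
    · exact Or.inl h
    · exact Or.inr (Or.inl (Or.inr h))
  obtain ⟨h₁, h₂⟩ := greenR_iff.1 h
  exact (jset_subset (key h₁)).antisymm (jset_subset (key h₂))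

/-- Since `b` is additively regular, both outer summands can be taken in `S`. -/
lemma AddRegular.exists_eq_add_add {a b : S} (hb : AddRegular b) (h : a ∈ jset b) :
    ∃ x y, a = x + b + y := by
  obtain ⟨c, hc⟩ := hb
  have hcc : b = b + c + b + (c + b) := by
    rw [hc, ← add_assoc, hc]
  rcases h with rfl | ((⟨s, rfl⟩ | ⟨s, rfl⟩) | ⟨s, t, rfl⟩)
  · exact ⟨_, _, hcc⟩
  · exact ⟨s + (b + c), c + b, by rw [add_assoc s, add_assoc s, ← hcc]⟩
  · exact ⟨b + c, c + b + s, by rw [← add_assoc _ _ s, ← hcc]⟩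
  · exact ⟨s, t, rfl⟩

lemma nmul_succ' (n : ℕ) (a : S) : nmul (n + 1) a = a + nmul n a := by
  induction n with
  | zero => rfl
  | succ n ih =>
    calc nmul (n + 1) a + a = a + nmul n a + a := by rw [ih]
      _ = a + nmul (n + 1) a := add_assoc _ _ _

lemma eq_nmul_add_add_nmul {u p q : S} (h : u = p + u + q) (n : ℕ) :
    u = nmul n p + u + nmul n q := by
  induction n with
  | zero => exact h
  | succ n ih =>
    calc u = nmul n p + u + nmul n q := ih
      _ = nmul n p + (p + u + q) + nmul n q := by rw [← h]
      _ = nmul (n + 1) p + u + nmul (n + 1) q := by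
        rw [nmul_succ' n q, nmul]
        simp only [add_assoc]

lemma QuasiCompletelyRegular.exists_eq_add_left (hS : QuasiCompletelyRegular S)
    {u p q : S} (h : u = p + u + q) : ∃ s, u = s + p + u := by
  obtain ⟨n, t, hg, hcomm, -⟩ := hS p
  have hu := eq_nmul_add_add_nmul h n
  have key : u = t + nmul n p + u := by
    calc u = nmul n p + u + nmul n q := hu
      _ = nmul n p + t + nmul n p + u + nmul n q := by rw [← hg]
      _ = t + nmul n p + (nmul n p + u + nmul n q) := by
        rw [hcomm]
        simp only [add_assoc]
      _ = t + nmul n p + u := by rw [← hu]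
  cases n with
  | zero => exact ⟨t, key⟩
  | succ n => exact ⟨t + nmul n p, by rw [add_assoc t]; exact key⟩

lemma QuasiCompletelyRegular.exists_eq_add_right (hS : QuasiCompletelyRegular S)
    {u p q : S} (h : u = p + u + q) : ∃ s, u = u + q + s := by
  obtain ⟨n, t, hg, hcomm, -⟩ := hS q
  have hu := eq_nmul_add_add_nmul h n
  have key : u = u + (nmul n q + t) := by
    calc u = nmul n p + u + nmul n q := hu
      _ = nmul n p + u + (nmul n q + t + nmul n q) := by rw [← hg]
      _ = nmul n p + u + nmul n q + (nmul n q + t) := by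
        rw [add_assoc (nmul n q) t, ← hcomm]
        simp only [add_assoc]
      _ = u + (nmul n q + t) := by rw [← hu]
  cases n with
  | zero => exact ⟨t, by rw [add_assoc]; exact key⟩
  | succ n =>
    refine ⟨nmul n q + t, ?_⟩
    rwa [nmul_succ', add_assoc q, ← add_assoc u] at key

/-- Between additively regular elements, `J⁺ ⊆ L⁺ ∘ R⁺` through a regular element. -/
lemma QuasiCompletelyRegular.exists_greenL_greenR (hS : QuasiCompletelyRegular S)
    {u v : S} (hu : AddRegular u) (hv : AddRegular v) (h : GreenJ u v) :
    ∃ c, AddRegular c ∧ GreenL u c ∧ GreenR c v := by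
  have huv : u ∈ jset v := h ▸ Set.mem_insert u _
  have hvu : v ∈ jset u := h ▸ Set.mem_insert v _
  obtain ⟨x, y, hxy⟩ := hv.exists_eq_add_add huv
  obtain ⟨z, w, hzw⟩ := hu.exists_eq_add_add hvu
  have e : u = (x + z) + u + (w + y) := by
    calc u = x + (z + u + w) + y := by rw [← hzw]; exact hxy
      _ = _ := by simp only [add_assoc]
  obtain ⟨s, hs⟩ := hS.exists_eq_add_left e
  obtain ⟨t, ht⟩ := hS.exists_eq_add_right e
  have hs' : u = (s + x) + (z + u) := by simpa only [add_assoc] using hs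
  have ht' : u = u + w + (y + t) := by simpa only [add_assoc] using ht
  refine ⟨z + u, ?_, greenL_iff.2 ⟨Or.inr ⟨_, hs'⟩, Or.inr ⟨z, rfl⟩⟩,
    greenR_iff.2 ⟨Or.inr ⟨y + t, ?_⟩, Or.inr ⟨w, hzw⟩⟩⟩
  · obtain ⟨u', hu'⟩ := hu
    refine ⟨u' + (s + x), ?_⟩
    calc z + u + (u' + (s + x)) + (z + u) = z + (u + u' + ((s + x) + (z + u))) := by
          simp only [add_assoc]
      _ = z + u := by rw [← hs', hu']
  · calc z + u = z + (u + w + (y + t)) := by rw [← ht']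
      _ = v + (y + t) := by rw [hzw]; simp only [add_assoc]

lemma LeastReg.unique {a : S} {m n : ℕ} (hm : LeastReg a m) (hn : LeastReg a n) : m = n :=
  le_antisymm (not_lt.1 fun h => hm.2 n h hn.1) (not_lt.1 fun h => hn.2 m h hm.1)

lemma AddRegular.leastReg_zero {a : S} (h : AddRegular a) : LeastReg a 0 :=
  ⟨h, fun _ hm => absurd hm (Nat.not_lt_zero _)⟩

end PSemiring

/-- In any quasi completely regular semiring `S`, the relations
`J*⁺` and `D*⁺` coincide. -/
theorem jstar_eq_dstar {S : Type*} [PSemiring S]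
    (hS : QuasiCompletelyRegular S) :
    ∀ a b : S, JStar a b ↔ DStar a b := by
  intro a b
  constructor
  · rintro ⟨p, q, hp, hq, h⟩
    obtain ⟨c, hc, hL, hR⟩ := hS.exists_greenL_greenR hp.1 hq.1 h
    exact ⟨c, ⟨p, 0, hp, hc.leastReg_zero, hL⟩, ⟨0, q, hc.leastReg_zero, hq, hR⟩⟩
  · rintro ⟨c, ⟨p, r, hp, hr, hL⟩, ⟨r', q, hr', hq, hR⟩⟩
    obtain rfl := hr.unique hr'
    exact ⟨p, q, hp, hq, hL.greenJ.trans hR.greenJ⟩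
end

section
/- Let S be a quasi completely regular semiring. Then the relation 𝒴 is the least b-lattice-of-skew-rings congruence on S if and only if S is quasi-orthodox. -/
open PSemiring

namespace PSemiring

variable {S : Type*} [PSemiring S]

theorem nmul_add_self_comm (n : ℕ) (a : S) : nmul n a + a = a + nmul n a := by
  induction n with
  | zero => rfl
  | succ n ih => rw [nmul, ← add_assoc, ← ih]

theorem nmul_mul (n : ℕ) (a b : S) : nmul n a * b = nmul n (a * b) := by
  induction n with
  | zero => rfl
  | succ n ih => rw [nmul, right_distrib, ih, nmul]

theorem mul_nmul (n : ℕ) (a b : S) : b * nmul n a = nmul n (b * a) := by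
  induction n with
  | zero => rfl
  | succ n ih => rw [nmul, left_distrib, ih, nmul]

theorem AddIdem.nmul_eq {e : S} (he : AddIdem e) (n : ℕ) : nmul n e = e := by
  induction n with
  | zero => rfl
  | succ n ih => rw [nmul, ih, he]

theorem AddIdem.mul_right {e : S} (he : AddIdem e) (a : S) : AddIdem (e * a) := by
  rw [AddIdem, ← right_distrib, he]

theorem AddIdem.mul_left {e : S} (he : AddIdem e) (a : S) : AddIdem (a * e) := by
  rw [AddIdem, ← left_distrib, he]

/-- `e` is the identity of an additive subgroup which contains some positive multiple of `a`;
`x` is the inverse of `a + e` in that subgroup. -/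
structure IsLocalZero (a e x : S) : Prop where
  idem : AddIdem e
  add_inv : a + x = e
  inv_add : x + a = e
  zero_add_inv : e + x = x
  inv_add_zero : x + e = x
  exists_nmul : ∃ n, e + nmul n a = nmul n a ∧ nmul n a + e = nmul n a

theorem inverse_comm {a b x : S} (h1 : b = b + x + b) (h2 : x = x + b + x)
    (h3 : b + x = x + b) (hc : b + a = a + b) : x + a = a + x := by
  have hl : b + x + a = b + x + a + (b + x) := by
    calc b + x + a = x + (b + a) := by rw [h3, add_assoc]
      _ = x + (a + (b + x + b)) := by rw [hc, ← h1]
      _ = x + (a + b) + (x + b) := by simp only [add_assoc]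
      _ = b + x + a + (b + x) := by rw [← hc, ← h3, ← add_assoc x, ← h3]
  have hr : a + (b + x) = b + x + a + (b + x) := by
    calc a + (b + x) = b + a + x := by rw [hc, add_assoc]
      _ = b + x + b + a + x := by rw [← h1]
      _ = b + x + (b + a) + x := by simp only [add_assoc]
      _ = b + x + a + (b + x) := by rw [hc]; simp only [add_assoc]
  have hba : b + x + a = a + (b + x) := hl.trans hr.symm
  calc x + a = x + (b + x + a) := by rw [← add_assoc, ← add_assoc, ← h2]
    _ = x + (a + b) + x := by rw [hba]; simp only [add_assoc]
    _ = b + x + a + x := by rw [← hc, ← add_assoc, ← h3]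
    _ = a + x := by rw [hba, add_assoc, h3, ← h2]

theorem IsZeroOf.exists_isLocalZero {a e : S} (h : IsZeroOf a e) : ∃ x, IsLocalZero a e x := by
  obtain ⟨n, x, -, h1, h2, h3, rfl⟩ := h
  have hidem : AddIdem (nmul n a + x) := by rw [AddIdem, ← add_assoc, ← h1]
  have hn : ∃ m, nmul n a + x + nmul m a = nmul m a ∧ nmul m a + (nmul n a + x) = nmul m a :=
    ⟨n, h1.symm, by rw [h3, ← add_assoc, ← h1]⟩
  have hxa := inverse_comm h1 h2 h3 (nmul_add_self_comm n a)
  cases n with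
  | zero =>
    exact ⟨x, hidem, rfl, h3.symm, by rw [h3, ← h2], by rw [← add_assoc, ← h2], hn⟩
  | succ n =>
    have hxc : x + nmul n a = nmul n a + x :=
      inverse_comm h1 h2 h3 (by rw [nmul, add_assoc, ← nmul_add_self_comm])
    refine ⟨nmul n a + x, hidem, ?_, ?_, ?_, ?_, hn⟩
    · rw [← add_assoc, ← nmul_add_self_comm, nmul]
    · rw [add_assoc, hxa, ← add_assoc, nmul]
    · rw [← hxc, ← add_assoc, h3, ← h2]
    · rw [add_assoc, ← add_assoc x, ← h2]

theorem IsLocalZero.exists_nmul_add {a e x : S} (h : IsLocalZero a e x) (k : ℕ) :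
    ∃ y, e + y = y ∧ nmul k a + y = e := by
  induction k with
  | zero => exact ⟨x, h.zero_add_inv, h.add_inv⟩
  | succ k ih =>
    obtain ⟨y, hy, hk⟩ := ih
    refine ⟨x + y, by rw [← add_assoc, h.zero_add_inv], ?_⟩
    rw [nmul, add_assoc, ← add_assoc a, h.add_inv, hy, hk]

theorem IsLocalZero.exists_add_nmul {a e x : S} (h : IsLocalZero a e x) (k : ℕ) :
    ∃ y, y + e = y ∧ y + nmul k a = e := by
  induction k with
  | zero => exact ⟨x, h.inv_add_zero, h.inv_add⟩
  | succ k ih =>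
    obtain ⟨y, hy, hk⟩ := ih
    refine ⟨y + x, by rw [add_assoc, h.inv_add_zero], ?_⟩
    rw [nmul, nmul_add_self_comm, add_assoc, ← add_assoc x, h.inv_add, ← add_assoc, hy, hk]

theorem add_nmul_of_le {a e : S} {n m : ℕ} (hnm : n ≤ m) (h : e + nmul n a = nmul n a) :
    e + nmul m a = nmul m a := by
  induction m, hnm using Nat.le_induction with
  | base => exact h
  | succ m _ ih => rw [nmul, ← add_assoc, ih]

theorem nmul_add_of_le {a e : S} {n m : ℕ} (hnm : n ≤ m) (h : nmul n a + e = nmul n a) :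
    nmul m a + e = nmul m a := by
  induction m, hnm using Nat.le_induction with
  | base => exact h
  | succ m _ ih => rw [nmul, nmul_add_self_comm, add_assoc, ih]

theorem IsLocalZero.unique {a e f x y : S} (he : IsLocalZero a e x) (hf : IsLocalZero a f y) :
    e = f := by
  obtain ⟨n, -, hn⟩ := he.exists_nmul
  obtain ⟨m, hm, -⟩ := hf.exists_nmul
  obtain ⟨u, -, hu⟩ := he.exists_nmul_add (max n m)
  obtain ⟨v, -, hv⟩ := hf.exists_add_nmul (max n m)
  have h1 := nmul_add_of_le (le_max_left n m) hn
  have h2 := add_nmul_of_le (le_max_right n m) hm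
  calc e = f + e := by rw [← hu, ← add_assoc, h2]
    _ = f := by rw [← hv, add_assoc, h1]

theorem IsLocalZero.mul_right {a e x : S} (h : IsLocalZero a e x) (b : S) :
    IsLocalZero (a * b) (e * b) (x * b) := by
  obtain ⟨h1, h2, h3, h4, h5, n, h6, h7⟩ := h
  refine ⟨h1.mul_right b, ?_, ?_, ?_, ?_, n, ?_, ?_⟩ <;>
    simp only [← nmul_mul, ← right_distrib, *]

theorem IsLocalZero.mul_left {a e x : S} (h : IsLocalZero a e x) (b : S) :
    IsLocalZero (b * a) (b * e) (b * x) := by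
  obtain ⟨h1, h2, h3, h4, h5, n, h6, h7⟩ := h
  refine ⟨h1.mul_left b, ?_, ?_, ?_, ?_, n, ?_, ?_⟩ <;>
    simp only [← mul_nmul, ← left_distrib, *]

theorem AddIdem.isLocalZero {e : S} (he : AddIdem e) : IsLocalZero e e e :=
  ⟨he, he, he, he, he, 0, he, he⟩

theorem AddIdem.mul_self {e w : S} (he : AddIdem e) (h : IsZeroOf e w) : e * e = e := by
  obtain ⟨n, -, ⟨⟨y, h1, h2, h3⟩, -⟩, -⟩ := h
  rw [he.nmul_eq] at h1 h2 h3
  have : e + y = e := by grind [AddIdem]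
  rwa [this] at h3

theorem IsLocalZero.mem_vplus {a e x : S} (h : IsLocalZero a e x) : x ∈ Vplus (a + e) := by
  have hc : e + a = a + e := by rw [← h.add_inv, add_assoc, h.inv_add, h.add_inv]
  constructor
  · rw [add_assoc a, h.zero_add_inv, h.add_inv, ← add_assoc, hc, add_assoc, h.idem]
  · rw [← add_assoc, h.inv_add, h.idem, h.zero_add_inv]

/-- The preorder on additive idempotents given by `e ≤ f` iff `e + f + e = e`. -/
def IdemLE (e f : S) : Prop := e + f + e = e

theorem idemLE_refl {e : S} (he : AddIdem e) : IdemLE e e := by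
  rw [IdemLE, he, he]

section ZeroMap

variable {z : S → S} (hz : ∀ a, IsZeroOf a (z a))

include hz

theorem addIdem_zero (a : S) : AddIdem (z a) := by
  obtain ⟨x, hx⟩ := (hz a).exists_isLocalZero
  exact hx.idem

theorem IsLocalZero.zero_eq {a e x : S} (h : IsLocalZero a e x) : z a = e := by
  obtain ⟨y, hy⟩ := (hz a).exists_isLocalZero
  exact hy.unique h

theorem AddIdem.zero_eq {e : S} (he : AddIdem e) : z e = e :=
  he.isLocalZero.zero_eq hz

theorem zero_add_comm (a : S) : z a + a = a + z a := by
  obtain ⟨x, hx⟩ := (hz a).exists_isLocalZero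
  rw [← hx.add_inv, add_assoc, hx.inv_add, hx.add_inv]

theorem zero_mul_right (a b : S) : z (a * b) = z a * b := by
  obtain ⟨x, hx⟩ := (hz a).exists_isLocalZero
  exact (hx.mul_right b).zero_eq hz

theorem zero_mul_left (a b : S) : z (a * b) = a * z b := by
  obtain ⟨x, hx⟩ := (hz b).exists_isLocalZero
  exact (hx.mul_left a).zero_eq hz

theorem zero_mul_self (a : S) : z a * z a = z a :=
  (addIdem_zero hz a).mul_self (hz _)

theorem zero_mul (a b : S) : z (a * b) = z a * z b := by
  rw [← zero_mul_left hz, zero_mul_right hz, (addIdem_zero hz a).mul_right b |>.zero_eq hz]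

theorem zero_add_mul (a b : S) {c : S} (hc : AddIdem c) :
    z (a + b) * c = z a * c + z b * c := by
  rw [← zero_mul_right hz, ← zero_mul_right hz, ← zero_mul_right hz,
    (hc.mul_left _).zero_eq hz, (hc.mul_left _).zero_eq hz, (hc.mul_left _).zero_eq hz,
    right_distrib]

theorem mul_zero_add (a b : S) {c : S} (hc : AddIdem c) :
    c * z (a + b) = c * z a + c * z b := by
  rw [← zero_mul_left hz, ← zero_mul_left hz, ← zero_mul_left hz,
    (hc.mul_right _).zero_eq hz, (hc.mul_right _).zero_eq hz, (hc.mul_right _).zero_eq hz,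
    left_distrib]

theorem zero_add_eq (a b : S) :
    z (a + b) = z a + z a * z b + (z b * z a + z b) := by
  have h := zero_mul_self hz (a + b)
  rw [zero_add_mul hz a b (addIdem_zero hz _), mul_zero_add hz a b (addIdem_zero hz _),
    mul_zero_add hz a b (addIdem_zero hz _), zero_mul_self hz, zero_mul_self hz] at h
  exact h.symm

theorem zero_left_add_zero_add (a b : S) : z a + z (a + b) = z (a + b) := by
  rw [zero_add_eq hz, ← add_assoc, ← add_assoc (z a) (z a), addIdem_zero hz a]

theorem zero_add_add_zero_right (a b : S) : z (a + b) + z b = z (a + b) := by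
  rw [zero_add_eq hz, add_assoc, add_assoc _ _ (z b), addIdem_zero hz b]

theorem zero_add_of_regular {a b : S} (h : a + b + a = a) : z a + a = a := by
  have hi : AddIdem (a + b) := by rw [AddIdem, ← add_assoc, h]
  have h1 := zero_left_add_zero_add hz a b
  rw [hi.zero_eq hz] at h1
  calc z a + a = z a + (a + b) + a := by rw [add_assoc, h]
    _ = a := by rw [h1, h]

variable (hq : QuasiOrthodox S)

include hq

theorem addIdem_add_of_regular {e f y : S} (he : AddIdem e) (hf : AddIdem f)
    (h : e + f + y + (e + f) = e + f) : AddIdem (e + f) := by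
  obtain ⟨n, hn⟩ := hq e f he hf
  have hw := zero_add_of_regular hz h
  generalize e + f = w at *
  obtain ⟨x, hx⟩ := (hz w).exists_isLocalZero
  obtain ⟨v, -, hv⟩ := hx.exists_add_nmul n
  have : z w = w := by
    calc z w = v + nmul (n + 1) w := by rw [← hn, hv]
      _ = w := by rw [nmul, ← add_assoc, hv, hw]
  rw [← this]
  exact addIdem_zero hz w

theorem idemLE_zero {e s a t : S} (he : AddIdem e) (h : e = s + a + t) : IdemLE e (z a) := by
  have h1 := zero_add_add_zero_right hz s (a + t)
  rw [← add_assoc, ← h, he.zero_eq hz, ← zero_left_add_zero_add hz a t, ← add_assoc] at h1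
  have h2 : AddIdem (e + z a) :=
    addIdem_add_of_regular hz hq (y := z (a + t)) he (addIdem_zero hz a)
      (by rw [h1, ← add_assoc, he])
  calc e + z a + e = e + z a + (e + z a + z (a + t)) := by rw [h1]
    _ = e := by rw [← add_assoc, h2, h1]

theorem idemLE_trans {e f g : S} (he : AddIdem e) (hg : AddIdem g)
    (h1 : IdemLE e f) (h2 : IdemLE f g) : IdemLE e g := by
  have := idemLE_zero hz hq (s := e + f) (a := g) (t := f + e) he (by
    calc e = e + (f + g + f) + e := by rw [h2, h1]
      _ = e + f + g + (f + e) := by simp only [add_assoc])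
  rwa [hg.zero_eq hz] at this

theorem zero_add_idemLE_left (a b : S) : IdemLE (z (a + b)) (z a) := by
  obtain ⟨x, hx⟩ := (hz (a + b)).exists_isLocalZero
  refine idemLE_zero hz hq (s := z (a + b)) (t := b + x) (addIdem_zero hz _) ?_
  rw [add_assoc, ← add_assoc a, hx.add_inv, addIdem_zero hz]

theorem zero_add_idemLE_right (a b : S) : IdemLE (z (a + b)) (z b) := by
  obtain ⟨x, hx⟩ := (hz (a + b)).exists_isLocalZero
  refine idemLE_zero hz hq (s := x + a) (t := z (a + b)) (addIdem_zero hz _) ?_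
  rw [add_assoc x, hx.inv_add, addIdem_zero hz]

theorem zero_add_idemLE_comm (a b : S) : IdemLE (z (a + b)) (z (b + a)) := by
  obtain ⟨x, hx⟩ := (hz (a + b)).exists_isLocalZero
  refine idemLE_zero hz hq (s := a) (t := b + x + x) (addIdem_zero hz _) ?_
  calc z (a + b) = a + b + z (a + b) + x := by
        rw [← zero_add_comm hz, add_assoc, hx.add_inv, addIdem_zero hz]
    _ = a + b + (a + b + x) + x := by rw [hx.add_inv]
    _ = a + (b + a) + (b + x + x) := by simp only [add_assoc]

theorem idemLE_zero_add {e a b : S} (he : AddIdem e) (ha : IdemLE e (z a)) (hb : IdemLE e (z b)) :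
    IdemLE e (z (a + b)) := by
  obtain ⟨x, hx⟩ := (hz a).exists_isLocalZero
  obtain ⟨y, hy⟩ := (hz b).exists_isLocalZero
  have h : e = e + (a + ((x + e + y) + b)) + e := by
    calc e = e + z a + e + z b + e := by rw [ha, hb]
      _ = e + (a + x) + e + (y + b) + e := by rw [hx.add_inv, hy.inv_add]
      _ = _ := by simp only [add_assoc]
  have hi := addIdem_zero hz
  have h1 := idemLE_zero hz hq he h
  have h2 := idemLE_trans hz hq he (hi _) h1 (zero_add_idemLE_comm hz hq _ _)
  rw [add_assoc] at h2
  have h3 := idemLE_trans hz hq he (hi _) h2 (zero_add_idemLE_right hz hq _ _)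
  exact idemLE_trans hz hq he (hi _) h3 (zero_add_idemLE_comm hz hq _ _)

theorem add_add_eq_of_idemLE {g e k : S} (hg : AddIdem g) (he : AddIdem e) (hk : AddIdem k)
    (hgk : IdemLE g k) (hkg : IdemLE k g) (hge : IdemLE g e) : g + e + k = g + k := by
  have hi : AddIdem (g + e) := by rw [AddIdem, ← add_assoc, hge]
  have hm : AddIdem (g + k) := by rw [AddIdem, ← add_assoc, hgk]
  have hig : IdemLE (g + e) g := by
    rw [IdemLE, add_assoc _ g, ← add_assoc g g, hg, hi]
  have hik : IdemLE (g + e) k := idemLE_trans hz hq hi hk hig hgk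
  have hn : AddIdem (g + e + k) := by rw [AddIdem, ← add_assoc, hik]
  have hmg : IdemLE (g + k) g := by
    rw [IdemLE, add_assoc _ g, ← add_assoc g g, hg, hm]
  have hme := idemLE_trans hz hq hm he hmg hge
  have hmk := idemLE_trans hz hq hm hk hmg hgk
  have h := idemLE_zero_add hz hq hm (idemLE_zero_add hz hq hm (a := g) (b := e)
    (by rwa [hg.zero_eq hz]) (by rwa [he.zero_eq hz])) (b := k) (by rwa [hk.zero_eq hz])
  rw [hn.zero_eq hz] at h
  calc g + e + k = g + k + g + e + (k + g + k) := by rw [hgk, hkg]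
    _ = g + k + (g + e + k) + (g + k) := by simp only [add_assoc]
    _ = g + k := h

theorem exists_right_unit {h a : S} (hh : AddIdem h) (ha : IdemLE h (z a)) :
    h + a + z (h + a) = h + a ∧ IdemLE h (z (h + a)) ∧ IdemLE (z (h + a)) h := by
  have h1 : IdemLE h (z h) := by rw [hh.zero_eq hz]; exact idemLE_refl hh
  have h2 : IdemLE h (z (h + a)) := idemLE_zero_add hz hq hh h1 ha
  have h3 := zero_add_idemLE_left hz hq h a
  rw [hh.zero_eq hz] at h3
  refine ⟨?_, h2, h3⟩
  have hc := zero_add_comm hz (h + a)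
  have hi := addIdem_zero hz (h + a)
  have hw : h + a = h + (h + a) := by rw [← add_assoc, hh]
  generalize h + a = w at *
  have : w = h + (w + z w) := by
    calc w = h + z w + h + w := by rw [h2, ← hw]
      _ = h + (z w + (h + w)) := by simp only [add_assoc]
      _ = h + (w + z w) := by rw [← hw, hc]
  calc w + z w = h + (w + (z w + z w)) := by rw [← add_assoc, ← hw, hi]
    _ = w := by rw [hi, ← this]

theorem exists_left_unit {h a : S} (hh : AddIdem h) (ha : IdemLE h (z a)) :
    z (a + h) + (a + h) = a + h ∧ IdemLE h (z (a + h)) ∧ IdemLE (z (a + h)) h := by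
  have h1 : IdemLE h (z h) := by rw [hh.zero_eq hz]; exact idemLE_refl hh
  have h2 : IdemLE h (z (a + h)) := idemLE_zero_add hz hq hh ha h1
  have h3 := zero_add_idemLE_right hz hq a h
  rw [hh.zero_eq hz] at h3
  refine ⟨?_, h2, h3⟩
  have hc := zero_add_comm hz (a + h)
  have hi := addIdem_zero hz (a + h)
  have hw : a + h = a + h + h := by rw [add_assoc, hh]
  generalize a + h = w at *
  have : w = z w + w + h := by
    calc w = w + (h + z w + h) := by rw [h2, ← hw]
      _ = (w + h) + z w + h := by simp only [add_assoc]
      _ = z w + w + h := by rw [← hw, hc]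
  calc z w + w = z w + z w + w + h := by rw [add_assoc, ← hw, hi]
    _ = w := by rw [hi, ← this]

theorem remove_idem {h a e b : S} (hh : AddIdem h) (he : AddIdem e) (ha : IdemLE h (z a))
    (hhe : IdemLE h e) (hb : IdemLE h (z b)) : h + a + e + (b + h) = h + a + (b + h) := by
  obtain ⟨a1, a2, a3⟩ := exists_right_unit hz hq hh ha
  obtain ⟨b1, b2, b3⟩ := exists_left_unit hz hq hh hb
  have hi := addIdem_zero hz
  have key := add_add_eq_of_idemLE hz hq (hi (h + a)) he (hi (b + h))
    (idemLE_trans hz hq (hi _) (hi _) a3 b2) (idemLE_trans hz hq (hi _) (hi _) b3 a2)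
    (idemLE_trans hz hq (hi _) he a3 hhe)
  generalize z (h + a) = g at *
  generalize z (b + h) = k at *
  rw [← a1, ← b1]
  calc _ = h + a + (g + e + k) + (b + h) := by simp only [add_assoc]
    _ = _ := by rw [key]; simp only [add_assoc]

/-- `a ↦ h + a + h` is additive on the elements lying above `h`. -/
theorem sandwich_add {h a b : S} (hh : AddIdem h) (ha : IdemLE h (z a)) (hb : IdemLE h (z b)) :
    h + (a + b) + h = h + a + h + (h + b + h) := by
  have := remove_idem hz hq hh hh ha (idemLE_refl hh) hb
  calc _ = h + a + (b + h) := by simp only [add_assoc]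
    _ = h + a + (h + h) + (b + h) := by rw [hh, this]
    _ = _ := by simp only [add_assoc]

theorem sandwich_sandwich {h e a : S} (hh : AddIdem h) (he : AddIdem e) (hhe : IdemLE h e)
    (ha : IdemLE h (z a)) : h + (e + a + e) + h = h + a + h := by
  have he' : IdemLE h (z e) := by rwa [he.zero_eq hz]
  rw [sandwich_add hz hq hh (idemLE_zero_add hz hq hh he' ha) he',
    sandwich_add hz hq hh he' ha, hhe]
  have hh' : h + h = h := hh
  rw [← add_assoc, ← add_assoc, hh', add_assoc _ h h, hh']

theorem IsLocalZero.idemLE {a e x : S} (hx : IsLocalZero a e x) :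
    IdemLE e (z x) ∧ IdemLE (z x) e := by
  constructor
  · exact idemLE_zero hz hq (s := e) (t := a) hx.idem (by rw [add_assoc, hx.inv_add, hx.idem])
  · have := zero_add_idemLE_left hz hq e x
    rwa [hx.zero_add_inv, hx.idem.zero_eq hz] at this

theorem sandwich_eq_of_idemLE {h a b : S} (hh : AddIdem h) (hab : z a + a + z a = z a + b + z a)
    (ha : IdemLE h (z a)) (hb : IdemLE h (z b)) : h + a + h = h + b + h := by
  rw [← sandwich_sandwich hz hq hh (addIdem_zero hz a) ha ha, hab,
    sandwich_sandwich hz hq hh (addIdem_zero hz a) ha hb]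

theorem idemLE_zero_add_zero {h a : S} (hh : AddIdem h) (ha : IdemLE h (z a)) :
    IdemLE h (z (a + z a)) :=
  idemLE_zero_add hz hq hh ha (by rwa [(addIdem_zero hz a).zero_eq hz])

theorem sandwich_add_zero {h a : S} (hh : AddIdem h) (ha : IdemLE h (z a)) :
    h + (a + z a) + h = h + a + h := by
  rw [sandwich_add hz hq hh ha (by rwa [(addIdem_zero hz a).zero_eq hz]), ha, add_assoc, hh]

theorem sandwich_eq_of_yrel {a b : S} (h : Yrel z a b) :
    IdemLE (z a) (z b) ∧ z a + a + z a = z a + b + z a := by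
  obtain ⟨x, hx⟩ := (hz a).exists_isLocalZero
  have hi := addIdem_zero hz
  have hxV := hx.mem_vplus
  rw [h] at hxV
  have h1 : z a = x + b + z b + (x + a) := by
    calc z a = x + (b + z b) + x + a := by rw [hxV.2, hx.inv_add]
      _ = _ := by simp only [add_assoc]
  have hle : IdemLE (z a) (z b) := by
    have := idemLE_zero hz hq (hi _) h1
    rwa [(hi b).zero_eq hz] at this
  refine ⟨hle, ?_⟩
  rw [← sandwich_add_zero hz hq (hi a) hle]
  calc z a + a + z a = a + (x + (b + z b) + x) + a := by
        rw [hxV.2, hx.add_inv, add_assoc, ← zero_add_comm hz, ← add_assoc, hi]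
    _ = a + x + (b + z b) + (x + a) := by simp only [add_assoc]
    _ = _ := by rw [hx.add_inv, hx.inv_add]

theorem vplus_subset {a b : S} (hab : IdemLE (z a) (z b)) (hba : IdemLE (z b) (z a))
    (h : z a + a + z a = z a + b + z a) : Vplus (a + z a) ⊆ Vplus (b + z b) := by
  rintro x ⟨h1, h2⟩
  have hi := addIdem_zero hz
  obtain ⟨y, hy⟩ := (hz a).exists_isLocalZero
  have hax : IdemLE (z a) (z x) := by
    refine idemLE_zero hz hq (s := a + z a) (t := a + z a + y) (hi a) ?_
    rw [← add_assoc, h1, add_assoc, hy.zero_add_inv, hy.add_inv]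
  have hxa : IdemLE (z x) (z a) := by
    have := zero_add_idemLE_left hz hq (x + a) (z a + x)
    rw [show x + a + (z a + x) = x by rw [← add_assoc, add_assoc x, h2]] at this
    exact idemLE_trans hz hq (hi _) (hi _) this (zero_add_idemLE_right hz hq _ _)
  have hxb := idemLE_trans hz hq (hi x) (hi b) hxa hab
  have hbx := idemLE_trans hz hq (hi b) (hi x) hba hax
  have key : ∀ e, AddIdem e → IdemLE e (z a) → IdemLE e (z b) →
      e + (a + z a) + e = e + (b + z b) + e := fun e he ea eb => by
    rw [sandwich_add_zero hz hq he ea, sandwich_add_zero hz hq he eb,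
      sandwich_eq_of_idemLE hz hq he h ea eb]
  have hB := idemLE_refl (hi b)
  have hX := idemLE_refl (hi x)
  have kb := key (z b) (hi b) hba hB
  have kx := key (z x) (hi x) hxa hxb
  have b1 := idemLE_zero_add_zero hz hq (hi b) hba
  have b2 := idemLE_zero_add_zero hz hq (hi b) hB
  have x1 := idemLE_zero_add_zero hz hq (hi x) hxa
  have x2 := idemLE_zero_add_zero hz hq (hi x) hxb
  have hx' : z x + x = x := zero_add_of_regular hz (b := a + z a + x + (a + z a)) (by
    calc _ = x + (a + z a) + x + (a + z a) + x := by simp only [add_assoc]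
      _ = x := by rw [h2, h2])
  have hbz : b + z b + z b = b + z b := by rw [add_assoc, hi]
  have hzb : z b + (b + z b) = b + z b := by rw [← add_assoc, zero_add_comm hz, hbz]
  generalize a + z a = A at *
  generalize b + z b = B at *
  constructor
  · calc B + x + B = z b + (B + x + B) + z b := by
          rw [← add_assoc, ← add_assoc, hzb, add_assoc _ B, hbz]
      _ = z b + (A + x + A) + z b := by
          rw [sandwich_add hz hq (hi b) (idemLE_zero_add hz hq (hi b) b2 hbx) b2,
            sandwich_add hz hq (hi b) b2 hbx,
            sandwich_add hz hq (hi b) (idemLE_zero_add hz hq (hi b) b1 hbx) b1,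
            sandwich_add hz hq (hi b) b1 hbx, kb]
      _ = B := by rw [h1, kb, hzb, hbz]
  · calc x + B + x = z x + (x + B + x) + z x := by
          rw [← add_assoc, ← add_assoc, hx', add_assoc _ x, ← zero_add_comm hz, hx']
      _ = z x + (x + A + x) + z x := by
          rw [sandwich_add hz hq (hi x) (idemLE_zero_add hz hq (hi x) hX x2) hX,
            sandwich_add hz hq (hi x) hX x2,
            sandwich_add hz hq (hi x) (idemLE_zero_add hz hq (hi x) hX x1) hX,
            sandwich_add hz hq (hi x) hX x1, kx]
      _ = x := by rw [h2, hx', ← zero_add_comm hz, hx']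

theorem yrel_iff {a b : S} : Yrel z a b ↔
    IdemLE (z a) (z b) ∧ IdemLE (z b) (z a) ∧ z a + a + z a = z a + b + z a := by
  constructor
  · intro h
    obtain ⟨h1, h2⟩ := sandwich_eq_of_yrel hz hq h
    exact ⟨h1, (sandwich_eq_of_yrel hz hq h.symm).1, h2⟩
  · rintro ⟨h1, h2, h3⟩
    refine (vplus_subset hz hq h1 h2 h3).antisymm (vplus_subset hz hq h2 h1 ?_)
    exact (sandwich_eq_of_idemLE hz hq (addIdem_zero hz b) h3 h2
      (idemLE_refl (addIdem_zero hz b))).symm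

theorem zero_add_idemLE_zero_add {a b c d : S} (hab : IdemLE (z a) (z b))
    (hcd : IdemLE (z c) (z d)) : IdemLE (z (a + c)) (z (b + d)) :=
  have hi := addIdem_zero hz
  idemLE_zero_add hz hq (hi _)
    (idemLE_trans hz hq (hi _) (hi _) (zero_add_idemLE_left hz hq _ _) hab)
    (idemLE_trans hz hq (hi _) (hi _) (zero_add_idemLE_right hz hq _ _) hcd)

theorem isCong_idemLE : IsCong fun a b : S => IdemLE (z a) (z b) ∧ IdemLE (z b) (z a) := by
  have hi := addIdem_zero hz
  have hr := fun a => idemLE_refl (hi a)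
  have mull : ∀ c a b : S, IdemLE (z a) (z b) → IdemLE (z (c * a)) (z (c * b)) := by
    intro c a b h
    rw [IdemLE, zero_mul_left hz, zero_mul_left hz, ← left_distrib, ← left_distrib, h]
  have mulr : ∀ c a b : S, IdemLE (z a) (z b) → IdemLE (z (a * c)) (z (b * c)) := by
    intro c a b h
    rw [IdemLE, zero_mul_right hz, zero_mul_right hz, ← right_distrib, ← right_distrib, h]
  exact
  { refl a := ⟨hr a, hr a⟩
    symm h := h.symm
    trans h h' := ⟨idemLE_trans hz hq (hi _) (hi _) h.1 h'.1,
      idemLE_trans hz hq (hi _) (hi _) h'.2 h.2⟩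
    addl c _ _ h := ⟨zero_add_idemLE_zero_add hz hq (hr c) h.1,
      zero_add_idemLE_zero_add hz hq (hr c) h.2⟩
    addr c _ _ h := ⟨zero_add_idemLE_zero_add hz hq h.1 (hr c),
      zero_add_idemLE_zero_add hz hq h.2 (hr c)⟩
    mull c _ _ h := ⟨mull c _ _ h.1, mull c _ _ h.2⟩
    mulr c _ _ h := ⟨mulr c _ _ h.1, mulr c _ _ h.2⟩ }

theorem isCong_yrel : IsCong (Yrel z) := by
  have hi := addIdem_zero hz
  have hξ := isCong_idemLE hz hq
  have hl := zero_add_idemLE_left hz hq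
  have hr := zero_add_idemLE_right hz hq
  exact
  { refl a := rfl
    symm h := Eq.symm h
    trans h h' := Eq.trans h h'
    addl c a b h := by
      rw [yrel_iff hz hq] at h ⊢
      have h' := hξ.addl c ⟨h.1, h.2.1⟩
      refine ⟨h'.1, h'.2, ?_⟩
      have hb := idemLE_trans hz hq (hi _) (hi _) (hr c a) h.1
      rw [sandwich_add hz hq (hi _) (hl c a) (hr c a), sandwich_add hz hq (hi _) (hl c a) hb,
        sandwich_eq_of_idemLE hz hq (hi _) h.2.2 (hr c a) hb]
    addr c a b h := by
      rw [yrel_iff hz hq] at h ⊢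
      have h' := hξ.addr c ⟨h.1, h.2.1⟩
      refine ⟨h'.1, h'.2, ?_⟩
      have hb := idemLE_trans hz hq (hi _) (hi _) (hl a c) h.1
      rw [sandwich_add hz hq (hi _) (hl a c) (hr a c), sandwich_add hz hq (hi _) hb (hr a c),
        sandwich_eq_of_idemLE hz hq (hi _) h.2.2 (hl a c) hb]
    mull c a b h := by
      rw [yrel_iff hz hq] at h ⊢
      have h' := hξ.mull c ⟨h.1, h.2.1⟩
      refine ⟨h'.1, h'.2, ?_⟩
      simp only [zero_mul_left hz, ← left_distrib, h.2.2]
    mulr c a b h := by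
      rw [yrel_iff hz hq] at h ⊢
      have h' := hξ.mulr c ⟨h.1, h.2.1⟩
      refine ⟨h'.1, h'.2, ?_⟩
      simp only [zero_mul_right hz, ← right_distrib, h.2.2] }

theorem yrel_zero_add {a b : S} (h : IdemLE (z b) (z a)) :
    Yrel z (z a + b) b ∧ Yrel z (b + z a) b := by
  have hi := addIdem_zero hz
  have hB := idemLE_refl (hi b)
  have ha : IdemLE (z b) (z (z a)) := by rwa [(hi a).zero_eq hz]
  constructor
  · refine Eq.symm ((yrel_iff hz hq).2
      ⟨idemLE_zero_add hz hq (hi b) ha hB, zero_add_idemLE_right hz hq _ _, ?_⟩)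
    rw [sandwich_add hz hq (hi b) ha hB, h, ← add_assoc, ← add_assoc, hi]
  · refine Eq.symm ((yrel_iff hz hq).2
      ⟨idemLE_zero_add hz hq (hi b) hB ha, zero_add_idemLE_left hz hq _ _, ?_⟩)
    rw [sandwich_add hz hq (hi b) hB ha, h, add_assoc _ (z b), hi]

theorem isBLSRCong_yrel : IsBLSRCong (Yrel z) := by
  have hi := addIdem_zero hz
  have hξ := isCong_idemLE hz hq
  have hB := fun a => idemLE_refl (hi a)
  have hmul (a : S) : IdemLE (z (a * a)) (z a) ∧ IdemLE (z a) (z (a * a)) := by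
    rw [zero_mul hz, zero_mul_self hz]
    exact ⟨hB a, hB a⟩
  have hadd (a : S) : IdemLE (z (a + a)) (z a) ∧ IdemLE (z a) (z (a + a)) :=
    ⟨zero_add_idemLE_left hz hq _ _, idemLE_zero_add hz hq (hi _) (hB a) (hB a)⟩
  refine ⟨isCong_yrel hz hq, _, hξ, fun a b h => ?_, hmul, hadd,
    fun a b => ⟨zero_add_idemLE_comm hz hq _ _, zero_add_idemLE_comm hz hq _ _⟩,
    fun a b h => ⟨hξ.trans (hξ.addl a (hξ.symm h)) (hadd a),
      hξ.trans (hξ.mull a (hξ.symm h)) (hmul a)⟩, fun a b h => ?_⟩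
  · obtain ⟨h1, h2, -⟩ := (yrel_iff hz hq).1 h
    exact ⟨h1, h2⟩
  · obtain ⟨x, hx⟩ := (hz a).exists_isLocalZero
    have hxa := (hx.idemLE hz hq).symm
    have hy := yrel_zero_add hz hq h.2
    refine ⟨⟨x + b, hξ.trans (hξ.trans (hξ.addr b hxa) (hξ.addl a (hξ.symm h))) (hadd a), ?_⟩,
      b + x, hξ.trans (hξ.trans (hξ.addl b hxa) (hξ.addr a (hξ.symm h))) (hadd a), ?_⟩
    · rw [← add_assoc, hx.add_inv]
      exact hy.1
    · rw [add_assoc, hx.inv_add]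
      exact hy.2

end ZeroMap

theorem IsLocalZero.rel_zero {ξ : S → S → Prop} (hξ : IsCong ξ)
    (hadd : ∀ a, ξ (a + a) a) {a e x : S} (h : IsLocalZero a e x) : ξ e a ∧ ξ x a := by
  have hnm : ∀ n, ξ (nmul n a) a := by
    intro n
    induction n with
    | zero => exact hξ.refl a
    | succ n ih => exact hξ.trans (hξ.addr a ih) (hadd a)
  have hea : ξ e a := by
    obtain ⟨n, -, hn⟩ := h.exists_nmul
    have h1 : ξ (a + e) a := by
      have := hξ.trans (hξ.symm (hξ.addr e (hnm n))) (by rw [hn]; exact hnm n)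
      exact this
    have h2 : ξ (a + e) e := by
      have := hξ.addr x (hadd a)
      rwa [add_assoc, h.add_inv] at this
    exact hξ.trans (hξ.symm h2) h1
  have hxe : ξ x e := by
    have h1 : ξ (x + e) e := by
      have := hξ.addr a (hadd x)
      rwa [add_assoc, h.inv_add] at this
    rw [h.inv_add_zero] at h1
    exact h1
  exact ⟨hea, hξ.trans hxe hea⟩

section BLSR

variable {η ξ : S → S → Prop} (hη : IsCong η)
  (hg : ∀ a b, ξ a b → (∃ x, ξ x a ∧ η (a + x) b) ∧ ∃ y, ξ y a ∧ η (y + a) b)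

include hη hg

theorem add_right_of_idem {e a : S} (he : η (e + e) e) (h : ξ e a) : η (e + a) a := by
  obtain ⟨x, -, hx⟩ := (hg e a h).1
  refine hη.trans (hη.addl e (hη.symm hx)) (hη.trans ?_ hx)
  rw [← add_assoc]
  exact hη.addr x he

theorem add_left_of_idem {e a : S} (he : η (e + e) e) (h : ξ e a) : η (a + e) a := by
  obtain ⟨x, -, hx⟩ := (hg e a h).2
  refine hη.trans (hη.addr e (hη.symm hx)) (hη.trans ?_ hx)
  rw [add_assoc]
  exact hη.addl x he

variable (hξ : IsCong ξ) (hcomm : ∀ a b, ξ (a + b) (b + a))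

include hξ hcomm

theorem add_idem_of_idem {e f : S} (he : AddIdem e) (hf : AddIdem f) :
    η (e + f + (e + f)) (e + f) := by
  obtain ⟨x, hxw, hx⟩ := (hg (e + f) (e + f) (hξ.refl _)).1
  obtain ⟨y, -, hy⟩ := (hg (e + f) x (hξ.symm hxw)).2
  have hxx : η (x + x) x := by
    refine hη.trans (hη.addr x (hη.symm hy)) (hη.trans ?_ hy)
    rw [add_assoc]
    exact hη.addl y hx
  have absorb : ∀ g, AddIdem g → ξ (g + (e + f)) (e + f) → η (g + x) x := by
    intro g hgi hge
    have h1 : ξ x (g + x) := hξ.symm (hξ.trans (hξ.trans (hξ.addl g hxw) hge) (hξ.symm hxw))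
    have h2 : η (x + (g + x)) (g + x) := add_right_of_idem hη hg hxx h1
    have h3 : η (g + x + (g + x)) (g + x) := by
      have := hη.addl g h2
      rwa [← add_assoc, ← add_assoc g g, hgi] at this
    refine hη.trans ?_ (add_right_of_idem hη hg h3 (hξ.symm h1))
    have := hη.addl g (hη.symm hxx)
    rwa [← add_assoc] at this
  have hex := absorb e he (by rw [← add_assoc, he]; exact hξ.refl _)
  have hfx := absorb f hf (by
    have := hξ.trans (hξ.addl f (hcomm e f)) (?_ : ξ (f + (f + e)) (f + e))
    · exact hξ.trans this (hcomm f e)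
    · rw [← add_assoc, hf]; exact hξ.refl _)
  have hwx : η (e + f) x := by
    refine hη.trans (hη.symm hx) (hη.trans ?_ hex)
    rw [add_assoc]
    exact hη.addl e hfx
  exact hη.trans (hη.trans (hη.addl _ hwx) hx) (hη.refl _)

variable (hadd : ∀ a, ξ (a + a) a) {z : S → S} (hz : ∀ a, IsZeroOf a (z a))

include hadd hz

theorem rel_of_yrel {a b : S} (h : Yrel z a b) : η a b := by
  obtain ⟨x, hx⟩ := (hz a).exists_isLocalZero
  obtain ⟨y, hy⟩ := (hz b).exists_isLocalZero
  have hi := addIdem_zero hz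
  have hxV := hx.mem_vplus
  rw [h] at hxV
  obtain ⟨h1, h2⟩ := hxV
  obtain ⟨ha, hxa⟩ := hx.rel_zero hξ hadd
  obtain ⟨hb, -⟩ := hy.rel_zero hξ hadd
  have hidem : ∀ c, η (z c + z c) (z c) := fun c => by rw [hi]; exact hη.refl _
  have hbz : η (b + z b) b := add_left_of_idem hη hg (hidem b) hb
  have hbzξ : ξ (b + z b) b := hξ.trans (hξ.addl b hb) (hadd b)
  generalize b + z b = B at *
  have absorb : ∀ u v : S, u + v + u = u → ξ (u + v) u := fun u v huv => by
    have := hξ.trans (hξ.addl u (hcomm u v)) (?_ : ξ (u + (v + u)) u)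
    · refine hξ.trans (hξ.symm ?_) this
      rw [← add_assoc]
      exact hξ.addr v (hadd u)
    · rw [← add_assoc, huv]; exact hξ.refl _
  have hBx : ξ (B + x) B := absorb B x h1
  have hxB : ξ (x + B) x := absorb x B h2
  have hxb : ξ x b := hξ.trans (hξ.symm hxB) (hξ.trans (hcomm x B) (hξ.trans hBx hbzξ))
  have hab : ξ a b := hξ.trans (hξ.symm hxa) hxb
  have hBxi : η (B + x + (B + x)) (B + x) := by
    rw [← add_assoc, h1]; exact hη.refl _
  have e1 : η (B + x + a) a :=
    add_right_of_idem hη hg hBxi (hξ.trans hBx (hξ.trans hbzξ (hξ.symm hab)))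
  have e2 : η (b + z a) b := add_left_of_idem hη hg (hidem a) (hξ.trans ha hab)
  rw [add_assoc, hx.inv_add] at e1
  exact hη.trans (hη.symm e1) (hη.trans (hη.addr _ hbz) e2)

end BLSR

end PSemiring

/-- For a quasi completely regular semiring `S`, the relation `𝒴`
is the least b-lattice-of-skew-rings congruence on `S` iff `S` is
quasi-orthodox. -/
theorem yrel_least_blsr_iff_quasiOrthodox {S : Type*} [PSemiring S]
    (hS : QuasiCompletelyRegular S) (z : S → S) (hz : ∀ a, IsZeroOf a (z a)) :
    IsLeastBLSRCong (Yrel z) ↔ QuasiOrthodox S := by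
  constructor
  · rintro ⟨⟨hη, ξ, hξ, -, -, -, hcomm, -, hg⟩, -⟩ e f he hf
    obtain ⟨x, hx⟩ := (hz (e + f)).exists_isLocalZero
    have h := add_idem_of_idem hη hg hξ hcomm he hf
    have hzw : z (e + f + (e + f)) = z (e + f) := by
      rw [zero_add_eq hz, zero_mul_self hz, addIdem_zero hz, addIdem_zero hz]
    have hxV := hx.mem_vplus
    rw [Yrel, hzw] at h
    rw [← h] at hxV
    have h1 := hxV.2
    have hidem := addIdem_zero hz (e + f)
    generalize e + f = w at *
    have hxz : x = z w := by
      calc x = x + (w + w + z w) + x := h1.symm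
        _ = x + w + (w + (z w + x)) := by simp only [add_assoc]
        _ = z w := by rw [hx.zero_add_inv, hx.add_inv, hx.inv_add, hidem]
    obtain ⟨n, -, hn⟩ := hx.exists_nmul
    refine ⟨n, ?_⟩
    have h2 : z w + w = z w := by rw [← hxz, hx.inv_add, hxz]
    rw [nmul]
    calc nmul n w = nmul n w + (z w + w) := by rw [h2, hn]
      _ = nmul n w + w := by rw [← add_assoc, hn]
  · intro hq
    refine ⟨isBLSRCong_yrel hz hq, ?_⟩
    rintro η ⟨hη, ξ, hξ, -, -, hadd, hcomm, -, hg⟩ a b h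
    exact rel_of_yrel hη hg hξ hcomm hadd hz h
end
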